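/- arXiv:1610.04069 — 14 statements merged into one kernel-verified Lean document; each statement's English description precedes it below -/
import Mathlib

section
/- Let n ≥ 1 and let (w¹ᵢ)ᵢ₌₁^{2n+1} and (w²ᵢ)ᵢ₌₁^{2n+1} be real vectors such that: (1) Σᵢ₌₁ⁿ w¹ᵢ = Σᵢ₌₁ⁿ w²ᵢ and Σᵢ₌ₙ₊₁^{2n+1} w¹ᵢ = Σᵢ₌ₙ₊₁^{2n+1} w²ᵢ; (2) Σᵢ₌₁ⁿ w²ᵢ = Σᵢ₌ₙ₊₁^{2n+1} w²ᵢ; (3) w²₁ = w₀, w²ᵢ = w̄ for every 2 ≤ i ≤ 2n, and w²_{2n+1} = w_f, where 0 ≤ w̄ ≤ w₀ and w_f ≥ 0; (4) w¹ᵢ = w̄ + ε for every 1 ≤ i ≤ 2n for some ε ≥ 0, and w¹_{2n+1} = 0. Then for every real N ≥ 2n+1, Σᵢ₌₁^{2n+1} w¹ᵢ (N − 2i) ≥ Σᵢ₌₁^{2n+1} w²ᵢ (N − 2i). -/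
theorem sum_Icc_one_sub_two_mul (N : ℝ) (m : ℕ) :
    ∑ i ∈ Finset.Icc 1 m, (N - 2 * (i : ℝ)) = m * N - m * (m + 1) := by
  induction m with
  | zero => simp
  | succ k ih =>
    rw [Finset.sum_Icc_succ_top (by omega), ih]
    push_cast
    ring

/-- the weight-transfer inequality for the special vectors
`w² = (w₀, w̄, …, w̄, w_f)` and `w¹ = (w̄+ε, …, w̄+ε, 0)` of length `2n+1`. -/
theorem stmt2 (n : ℕ) (hn : 1 ≤ n) (w0 wbar wf ε : ℝ)
    (hwbar0 : 0 ≤ wbar) (hwbar : wbar ≤ w0) (hwf : 0 ≤ wf) (hε : 0 ≤ ε)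
    (w1 w2 : ℕ → ℝ)
    (hw2_first : w2 1 = w0)
    (hw2_mid : ∀ i : ℕ, 2 ≤ i → i ≤ 2 * n → w2 i = wbar)
    (hw2_last : w2 (2 * n + 1) = wf)
    (hw1 : ∀ i : ℕ, 1 ≤ i → i ≤ 2 * n → w1 i = wbar + ε)
    (hw1_last : w1 (2 * n + 1) = 0)
    (hsum1 : ∑ i ∈ Finset.Icc 1 n, w1 i = ∑ i ∈ Finset.Icc 1 n, w2 i)
    (hsum2 : ∑ i ∈ Finset.Icc (n + 1) (2 * n + 1), w1 i =
      ∑ i ∈ Finset.Icc (n + 1) (2 * n + 1), w2 i)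
    (hsum3 : ∑ i ∈ Finset.Icc 1 n, w2 i =
      ∑ i ∈ Finset.Icc (n + 1) (2 * n + 1), w2 i)
    (N : ℝ) (hN : (2 * n + 1 : ℝ) ≤ N) :
    ∑ i ∈ Finset.Icc 1 (2 * n + 1), w2 i * (N - 2 * (i : ℝ)) ≤
      ∑ i ∈ Finset.Icc 1 (2 * n + 1), w1 i * (N - 2 * (i : ℝ)) := by
  have hdiff : ∀ i ∈ Finset.Icc 1 (2 * n + 1), w1 i - w2 i =
      ε - (if i = 1 then w0 - wbar else 0) - (if i = 2 * n + 1 then ε + wf else 0) := by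
    intro i hi
    rw [Finset.mem_Icc] at hi
    rcases eq_or_ne i 1 with rfl | h1
    · rw [hw1 1 le_rfl (by omega), hw2_first, if_pos rfl, if_neg (by omega)]
      ring
    rcases eq_or_ne i (2 * n + 1) with rfl | h2
    · rw [hw1_last, hw2_last, if_neg h1, if_pos rfl]
      ring
    · rw [hw1 i hi.1 (by omega), hw2_mid i (by omega) (by omega), if_neg h1, if_neg h2]
      ring
  have hw0 : w0 - wbar = n * ε := by
    have h := sub_eq_zero.mpr hsum1
    rw [← Finset.sum_sub_distrib, Finset.sum_congr rfl fun i hi => hdiff i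
      (Finset.Icc_subset_Icc_right (by omega) hi)] at h
    have hout : ¬ 2 * n + 1 ≤ n := by omega
    simp [Finset.sum_sub_distrib, Finset.sum_ite_eq', hn, hout] at h
    linarith
  have hwf_eq : wf = n * ε := by
    have h := sub_eq_zero.mpr hsum2
    rw [← Finset.sum_sub_distrib, Finset.sum_congr rfl fun i hi => hdiff i
      (Finset.Icc_subset_Icc_left (by omega) hi)] at h
    have hcard : 2 * n + 1 + 1 - (n + 1) = n + 1 := by omega
    have hin : n ≤ 2 * n := by omega
    have hpos : n ≠ 0 := by omega
    simp [Finset.sum_sub_distrib, Finset.sum_ite_eq', hcard, hin, hpos] at h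
    linarith
  have hmain : ∑ i ∈ Finset.Icc 1 (2 * n + 1), w1 i * (N - 2 * (i : ℝ)) -
      ∑ i ∈ Finset.Icc 1 (2 * n + 1), w2 i * (N - 2 * (i : ℝ)) = 2 * (n * ε) := by
    rw [← Finset.sum_sub_distrib]
    simp_rw [← sub_mul]
    rw [Finset.sum_congr rfl fun i hi => by rw [hdiff i hi]]
    have hexpand : ∀ a b c d : ℝ, (a - b - c) * d = a * d - b * d - c * d := by
      intros
      ring
    simp_rw [hexpand, ite_mul, zero_mul]
    rw [Finset.sum_sub_distrib, Finset.sum_sub_distrib, ← Finset.mul_sum]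
    simp only [Finset.sum_ite_eq', Finset.mem_Icc]
    rw [sum_Icc_one_sub_two_mul, if_pos (by omega), if_pos (by omega), hw0, hwf_eq]
    push_cast
    ring
  have : 0 ≤ (n : ℝ) * ε := by positivity
  linarith
end

section
/- Let T ⊆ S with |T| = n ≥ 1, and let M be any perfect matching on S. Then w(M) ≤ (2/n)·w(T) + (1/n)·w(T, S∖T), i.e., the weight of M is at most (2/n) times the sum of w over unordered pairs of distinct elements of T plus (1/n) times the sum of w over pairs with one endpoint in T and the other in S∖T. -/
/-- if `T ⊆ S` with `|T| = n ≥ 1` and `M` is a perfect matching on `S`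
(encoded as a fixed-point-free involution `m` of `S`), then
`w(M) ≤ (2/n)·w(T) + (1/n)·w(T, S∖T)`, where `w(M) = (1/2)∑_{x∈S} w(x, m x)` and
`w(T) = (1/2)∑_{x,y ∈ T} w(x,y)`. -/
theorem stmt3 {V : Type*} [DecidableEq V] (S T : Finset V) (hTS : T ⊆ S)
    (n : ℕ) (hTn : T.card = n) (hn : 1 ≤ n)
    (w : V → V → ℝ)
    (hsymm : ∀ x y, w x y = w y x)
    (hnonneg : ∀ x y, 0 ≤ w x y)
    (hzero : ∀ x, w x x = 0)
    (htri : ∀ x y z, w x z ≤ w x y + w y z)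
    (m : V → V)
    (hminv : ∀ x ∈ S, m (m x) = x)
    (hmne : ∀ x ∈ S, m x ≠ x)
    (hmmem : ∀ x ∈ S, m x ∈ S) :
    (1/2) * ∑ x ∈ S, w x (m x) ≤
      (2 / (n : ℝ)) * ((1/2) * ∑ x ∈ T, ∑ y ∈ T, w x y) +
        (1 / (n : ℝ)) * ∑ x ∈ T, ∑ y ∈ S \ T, w x y := by
  have hstar : ∀ t ∈ T, (1/2) * ∑ x ∈ S, w x (m x) ≤ ∑ x ∈ S, w t x := by
    intro t _
    have hreindex : ∑ x ∈ S, w t (m x) = ∑ x ∈ S, w t x :=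
      Finset.sum_nbij' m m hmmem hmmem hminv hminv fun _ _ => rfl
    have hle : ∑ x ∈ S, w x (m x) ≤ ∑ x ∈ S, (w t x + w t (m x)) :=
      Finset.sum_le_sum fun x _ => by simpa only [hsymm x t] using htri x t (m x)
    rw [Finset.sum_add_distrib, hreindex] at hle
    linarith
  have hsum := Finset.card_nsmul_le_sum T _ _ hstar
  have hsplit : ∑ t ∈ T, ∑ x ∈ S, w t x
      = ∑ x ∈ T, ∑ y ∈ T, w x y + ∑ x ∈ T, ∑ y ∈ S \ T, w x y := by
    rw [← Finset.sum_add_distrib]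
    exact Finset.sum_congr rfl fun x _ => by rw [add_comm, Finset.sum_sdiff hTS]
  rw [hTn, nsmul_eq_mul, hsplit] at hsum
  have hpos : (0 : ℝ) < n := by exact_mod_cast hn
  calc (1/2) * ∑ x ∈ S, w x (m x)
      ≤ (∑ x ∈ T, ∑ y ∈ T, w x y + ∑ x ∈ T, ∑ y ∈ S \ T, w x y) / n :=
        (le_div_iff₀' hpos).mpr hsum
    _ = _ := by ring
end

section
/- Let V be a finite set with |V| = 2m, and let M = {e₁, …, e_m} be a perfect matching on V with weights w(e₁) ≥ w(e₂) ≥ … ≥ w(e_m), such that every unordered pair {x,y} of distinct elements of V either belongs to M or there is an edge of M containing x or containing y whose weight is at least w(x,y) (the charging property of a greedily constructed matching). Then for every perfect matching M* on V, w(M*) ≤ 2·Σᵢ₌₁^{⌈m/2⌉} w(eᵢ); in particular the top half of the greedy matching already has weight at least half the weight of the maximum-weight perfect matching. -/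
/-- If each index `i` has multiplicity at most `r` and the multiplicities sum to at most `r * k`,
then for antitone nonnegative weights the weighted sum is at most `r` times the sum of the
`k` largest weights. -/
theorem sum_mul_le_mul_sum_top {m k : ℕ} (hk : 0 < k) (hkm : k ≤ m) (W : Fin m → ℝ)
    (hW : Antitone W) (hW0 : ∀ i, 0 ≤ W i) (n : Fin m → ℝ) (r : ℝ) (hn0 : ∀ i, 0 ≤ n i)
    (hnr : ∀ i, n i ≤ r) (hsum : ∑ i, n i ≤ r * k) :
    ∑ i, n i * W i ≤ r * ∑ i ∈ Finset.univ.filter (fun i : Fin m => (i : ℕ) < k), W i := by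
  let l : Fin m := ⟨k - 1, by omega⟩
  have hpoint : ∀ i : Fin m, n i * W i - (if (i : ℕ) < k then r * W i else 0) ≤
      n i * W l - (if (i : ℕ) < k then r * W l else 0) := by
    intro i
    split_ifs with h
    · have : W l ≤ W i := hW (Fin.le_def.2 (by simp only [l]; omega))
      nlinarith [hnr i]
    · have : W i ≤ W l := hW (Fin.le_def.2 (by simp only [l]; omega))
      nlinarith [hn0 i]
  have hcount : ∑ i : Fin m, (if (i : ℕ) < k then r * W l else 0) = k * (r * W l) := by
    rw [← Finset.sum_filter, Finset.sum_const, Fin.card_filter_val_lt, min_eq_right hkm,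
      nsmul_eq_mul]
  have htotal := Finset.sum_le_sum (s := Finset.univ) fun i _ => hpoint i
  rw [Finset.sum_sub_distrib, Finset.sum_sub_distrib, hcount, ← Finset.sum_filter,
    ← Finset.mul_sum, ← Finset.sum_mul] at htotal
  nlinarith [mul_le_mul_of_nonneg_right hsum (hW0 l)]


/-- for a greedily constructed perfect matching `e₁,…,e_m` (edges sorted
by non-increasing weight, satisfying the charging property), every perfect matching `M*`
(encoded as a fixed-point-free involution `m'`) satisfies
`w(M*) ≤ 2 · ∑_{i=1}^{⌈m/2⌉} w(eᵢ)`. -/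
theorem stmt4 {V : Type*} [Fintype V] [DecidableEq V]
    (w : V → V → ℝ)
    (hsymm : ∀ x y, w x y = w y x)
    (hnonneg : ∀ x y, 0 ≤ w x y)
    (hzero : ∀ x, w x x = 0)
    (m : ℕ) (hcard : Fintype.card V = 2 * m)
    (p q : Fin m → V)
    (hp : Function.Injective p) (hq : Function.Injective q)
    (hpq : ∀ i j, p i ≠ q j)
    (hsorted : ∀ i j : Fin m, i ≤ j → w (p j) (q j) ≤ w (p i) (q i))
    (hcharge : ∀ a b : V, a ≠ b →
      (∃ i, (p i = a ∧ q i = b) ∨ (p i = b ∧ q i = a)) ∨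
      (∃ i, (p i = a ∨ q i = a ∨ p i = b ∨ q i = b) ∧ w a b ≤ w (p i) (q i)))
    (m' : V → V)
    (hm'inv : ∀ x, m' (m' x) = x)
    (hm'ne : ∀ x, m' x ≠ x) :
    (1/2) * ∑ x : V, w x (m' x) ≤
      2 * ∑ i ∈ Finset.univ.filter (fun i : Fin m => (i : ℕ) < (m + 1) / 2),
        w (p i) (q i) := by
  classical
  obtain rfl | hm := Nat.eq_zero_or_pos m
  · have : IsEmpty V := Fintype.card_eq_zero_iff.1 (by omega)
    simp
  have hcover : ∀ x, ∃ i, p i = x ∨ q i = x := by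
    have hbij : Function.Bijective (Sum.elim p q) :=
      (Fintype.bijective_iff_injective_and_card _).2
        ⟨hp.sumElim hq hpq, by simp [hcard]; omega⟩
    intro x
    obtain ⟨i | i, hi⟩ := hbij.2 x
    · exact ⟨i, Or.inl hi⟩
    · exact ⟨i, Or.inr hi⟩
  choose f hf using hcover
  have hf_unique : ∀ i x, (p i = x ∨ q i = x) → i = f x := by
    rintro i x (h | h) <;> rcases hf x with h' | h'
    · exact hp (h.trans h'.symm)
    · exact absurd (h.trans h'.symm) (hpq _ _)
    · exact absurd (h'.trans h.symm) (hpq _ _)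
    · exact hq (h.trans h'.symm)
  let W : Fin m → ℝ := fun i => w (p i) (q i)
  have hW : Antitone W := fun i j h => hsorted i j h
  let c : V → Fin m := fun x => min (f x) (f (m' x))
  have hle : ∀ x, w x (m' x) ≤ W (c x) := by
    intro x
    rcases hcharge x (m' x) (hm'ne x).symm with ⟨i, hi⟩ | ⟨i, hi, hw⟩
    · have hx : i = f x := hf_unique i x (by tauto)
      have hw : w x (m' x) = W i := by
        rcases hi with ⟨h₁, h₂⟩ | ⟨h₁, h₂⟩
        · simp only [W, h₁, h₂]
        · simp only [W, h₁, h₂, hsymm x]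
      exact hw.le.trans (hW (hx ▸ min_le_left _ _))
    · refine hw.trans (hW ?_)
      have hi' : i = f x ∨ i = f (m' x) := by
        rcases hi with h | h | h | h
        · exact Or.inl (hf_unique _ _ (Or.inl h))
        · exact Or.inl (hf_unique _ _ (Or.inr h))
        · exact Or.inr (hf_unique _ _ (Or.inl h))
        · exact Or.inr (hf_unique _ _ (Or.inr h))
      rcases hi' with rfl | rfl
      · exact min_le_left _ _
      · exact min_le_right _ _
  let n : Fin m → ℕ := fun i => (Finset.univ.filter fun x => c x = i).card
  have hn : ∀ i, n i ≤ 4 := by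
    intro i
    have hsub : (Finset.univ.filter fun x => c x = i) ⊆ {p i, q i, m' (p i), m' (q i)} := by
      intro x hx
      have hx : min (f x) (f (m' x)) = i := (Finset.mem_filter.1 hx).2
      simp only [Finset.mem_insert, Finset.mem_singleton]
      rcases min_choice (f x) (f (m' x)) with h | h
      · have := hf x
        rw [← h, hx] at this
        rcases this with h | h <;> simp [h]
      · have := hf (m' x)
        rw [← h, hx] at this
        rcases this with h | h <;> simp [h, hm'inv]
    exact (Finset.card_le_card hsub).trans Finset.card_le_four
  have hnsum : ∑ i, n i = 2 * m := by
    rw [← hcard, ← Finset.card_univ]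
    exact (Finset.card_eq_sum_card_fiberwise fun _ _ => Finset.mem_coe.2 (Finset.mem_univ _)).symm
  have hfiber : ∑ x, W (c x) = ∑ i, (n i : ℝ) * W i := by
    rw [← Finset.sum_fiberwise Finset.univ c]
    refine Finset.sum_congr rfl fun i _ => ?_
    rw [Finset.sum_congr rfl fun x hx => congrArg W (Finset.mem_filter.1 hx).2,
      Finset.sum_const, nsmul_eq_mul]
  have hmain := sum_mul_le_mul_sum_top (k := (m + 1) / 2) (by omega) (by omega) W hW
    (fun i => hnonneg _ _) (fun i => (n i : ℝ)) 4 (fun i => Nat.cast_nonneg _)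
    (fun i => by exact_mod_cast hn i)
    (by
      have : ∑ i, n i ≤ 4 * ((m + 1) / 2) := by omega
      exact_mod_cast this)
  have hsum := Finset.sum_le_sum (s := Finset.univ) fun x _ => hle x
  linarith
end

section
/- Let T be a finite set with |T| = n = 2m, and let M consist of edges e₁ = {x₁,y₁}, …, e_m = {x_m,y_m} forming a perfect matching on T in greedy order with weights wᵢ = w(xᵢ,yᵢ). Then the sum of w over all unordered pairs of distinct elements of T satisfies w(T) ≤ Σᵢ₌₁^m wᵢ + Σᵢ₌₁^m 2wᵢ(n − 2i). -/
/-- A double sum over a type covered disjointly by two injective families splits into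
blocks indexed by pairs of indices. -/
theorem sum_sum_eq_sum_sum_of_cover {V ι : Type*} [Fintype V] [Fintype ι]
    (w : V → V → ℝ) (p q : ι → V)
    (hp : Function.Injective p) (hq : Function.Injective q)
    (hpq : ∀ i j, p i ≠ q j)
    (hcover : ∀ v : V, (∃ i, p i = v) ∨ (∃ i, q i = v)) :
    ∑ x : V, ∑ y : V, w x y =
      ∑ i, ∑ j, (w (p i) (p j) + w (p i) (q j) + w (q i) (p j) + w (q i) (q j)) := by
  have hbij : Function.Bijective (Sum.elim p q) := by
    refine ⟨hp.sumElim hq hpq, fun v => ?_⟩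
    rcases hcover v with ⟨i, hi⟩ | ⟨i, hi⟩
    · exact ⟨Sum.inl i, hi⟩
    · exact ⟨Sum.inr i, hi⟩
  have hsum (f : V → ℝ) : ∑ x, f x = ∑ i, f (p i) + ∑ i, f (q i) := by
    rw [← hbij.sum_comp f, Fintype.sum_sum_type]
    simp
  simp only [hsum, Finset.sum_add_distrib]
  ring

/-- A double sum over `Fin m` is bounded by the diagonal plus twice the upper triangle, when the
entries at `(i, j)` and `(j, i)` with `i < j` are at most `a i`. -/
theorem sum_sum_le_of_le_of_lt {m : ℕ} (g : Fin m → Fin m → ℝ) (a : Fin m → ℝ)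
    (hle : ∀ i j, i < j → g i j ≤ a i) (hle' : ∀ i j, i < j → g j i ≤ a i) :
    ∑ i, ∑ j, g i j ≤
      ∑ i, g i i + 2 * ∑ i : Fin m, a i * ((m : ℝ) - ((i : ℕ) + 1)) := by
  have hrow (i : Fin m) :
      ∑ j, (if i < j then a i else 0) = a i * ((m : ℝ) - ((i : ℕ) + 1)) := by
    have hcard : ((Finset.univ.filter (i < ·)).card : ℝ) = (m : ℝ) - ((i : ℕ) + 1) := by
      rw [Finset.filter_lt_eq_Ioi, Fin.card_Ioi, Nat.sub_sub, Nat.cast_sub (by omega)]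
      push_cast
      ring
    rw [← Finset.sum_filter, Finset.sum_const, nsmul_eq_mul, hcard, mul_comm]
  calc ∑ i, ∑ j, g i j
      ≤ ∑ i, ∑ j, ((if i = j then g i i else 0) + (if i < j then a i else 0) +
          (if j < i then a j else 0)) := by
        refine Finset.sum_le_sum fun i _ => Finset.sum_le_sum fun j _ => ?_
        rcases lt_trichotomy i j with h | rfl | h
        · simpa [h, h.ne, h.not_gt] using hle i j h
        · simp
        · simpa [h, h.ne', h.not_gt] using hle' j i h
    _ = _ := by
        simp only [Finset.sum_add_distrib]
        rw [Finset.sum_comm (f := fun i j => if j < i then a j else 0)]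
        simp only [hrow, Finset.sum_ite_eq, Finset.mem_univ, if_true]
        ring


/-- if `e₁ = {x₁,y₁}, …, e_m = {x_m,y_m}` is a perfect matching on `T`
(`|T| = n = 2m`) in greedy order, then
`w(T) ≤ ∑ᵢ wᵢ + ∑ᵢ 2wᵢ(n − 2i)` where `wᵢ = w(xᵢ,yᵢ)` and
`w(T) = (1/2)∑_{x,y ∈ T} w(x,y)`. -/
theorem stmt5 {V : Type*} [Fintype V] [DecidableEq V]
    (w : V → V → ℝ)
    (hsymm : ∀ x y, w x y = w y x)
    (hnonneg : ∀ x y, 0 ≤ w x y)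
    (hzero : ∀ x, w x x = 0)
    (m n : ℕ) (hn : n = 2 * m) (hcard : Fintype.card V = n)
    (p q : Fin m → V)
    (hp : Function.Injective p) (hq : Function.Injective q)
    (hpq : ∀ i j, p i ≠ q j)
    (hcover : ∀ v : V, (∃ i, p i = v) ∨ (∃ i, q i = v))
    (hsorted : ∀ i j : Fin m, i ≤ j → w (p j) (q j) ≤ w (p i) (q i))
    (hgreedy : ∀ i j : Fin m, i < j →
      w (p i) (p j) ≤ w (p i) (q i) ∧ w (p i) (q j) ≤ w (p i) (q i) ∧
      w (q i) (p j) ≤ w (p i) (q i) ∧ w (q i) (q j) ≤ w (p i) (q i)) :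
    (1/2) * ∑ x : V, ∑ y : V, w x y ≤
      (∑ i, w (p i) (q i)) +
        ∑ i : Fin m, 2 * w (p i) (q i) * ((n : ℝ) - 2 * ((i : ℕ) + 1)) := by
  rw [sum_sum_eq_sum_sum_of_cover w p q hp hq hpq hcover]
  have hbound := sum_sum_le_of_le_of_lt
    (fun i j => w (p i) (p j) + w (p i) (q j) + w (q i) (p j) + w (q i) (q j))
    (fun i => 4 * w (p i) (q i))
    (fun i j hij => by
      obtain ⟨h₁, h₂, h₃, h₄⟩ := hgreedy i j hij
      linarith)
    (fun i j hij => by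
      obtain ⟨h₁, h₂, h₃, h₄⟩ := hgreedy i j hij
      linarith [hsymm (p j) (p i), hsymm (p j) (q i), hsymm (q j) (p i), hsymm (q j) (q i)])
  have hdiag : ∑ i, (w (p i) (p i) + w (p i) (q i) + w (q i) (p i) + w (q i) (q i)) =
      2 * ∑ i, w (p i) (q i) := by
    rw [Finset.mul_sum]
    refine Finset.sum_congr rfl fun i _ => ?_
    rw [hzero, hzero, hsymm (q i) (p i)]
    ring
  have htri : ∑ i : Fin m, 2 * w (p i) (q i) * ((n : ℝ) - 2 * ((i : ℕ) + 1)) =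
      ∑ i : Fin m, 4 * w (p i) (q i) * ((m : ℝ) - ((i : ℕ) + 1)) := by
    refine Finset.sum_congr rfl fun i _ => ?_
    rw [hn]
    push_cast
    ring
  rw [htri]
  linarith
end

section
/- Let T be a finite set with |T| = n = 2m, let e₁ = {x₁,y₁}, …, e_m = {x_m,y_m} be a perfect matching on T in greedy order with weights wᵢ = w(xᵢ,yᵢ), and suppose w* > 0 satisfies wᵢ ≤ w* for all i. Then the sum of w over all unordered pairs of distinct elements of T satisfies w(T) ≤ 2·W·(n − W/w*), where W = Σᵢ₌₁^m wᵢ is the weight of the matching. -/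
/-- if `e₁,…,e_m` is a perfect matching on `T` (`|T| = n = 2m`) in greedy
order, with all edge weights at most `w* > 0` and total weight `W`, then
`w(T) ≤ 2·W·(n − W/w*)`, where `w(T) = (1/2)∑_{x,y ∈ T} w(x,y)`. -/
theorem stmt7 {V : Type*} [Fintype V] [DecidableEq V]
    (w : V → V → ℝ)
    (hsymm : ∀ x y, w x y = w y x)
    (hnonneg : ∀ x y, 0 ≤ w x y)
    (hzero : ∀ x, w x x = 0)
    (m n : ℕ) (hn : n = 2 * m) (hcard : Fintype.card V = n)
    (p q : Fin m → V)
    (hp : Function.Injective p) (hq : Function.Injective q)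
    (hpq : ∀ i j, p i ≠ q j)
    (hcover : ∀ v : V, (∃ i, p i = v) ∨ (∃ i, q i = v))
    (hsorted : ∀ i j : Fin m, i ≤ j → w (p j) (q j) ≤ w (p i) (q i))
    (hgreedy : ∀ i j : Fin m, i < j →
      w (p i) (p j) ≤ w (p i) (q i) ∧ w (p i) (q j) ≤ w (p i) (q i) ∧
      w (q i) (p j) ≤ w (p i) (q i) ∧ w (q i) (q j) ≤ w (p i) (q i))
    (wstar : ℝ) (hwstar : 0 < wstar)
    (hub : ∀ i : Fin m, w (p i) (q i) ≤ wstar)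
    (W : ℝ) (hW : W = ∑ i, w (p i) (q i)) :
    (1/2) * ∑ x : V, ∑ y : V, w x y ≤ 2 * W * ((n : ℝ) - W / wstar) := by
  have sum_split : ∀ f : V → ℝ, ∑ x, f x = ∑ i, (f (p i) + f (q i)) := by
    intro f
    have hbij : Function.Bijective (Sum.elim p q) :=
      ⟨hp.sumElim hq hpq, fun v => (hcover v).elim
        (fun ⟨i, hi⟩ => ⟨Sum.inl i, hi⟩) (fun ⟨i, hi⟩ => ⟨Sum.inr i, hi⟩)⟩
    rw [← hbij.sum_comp, Fintype.sum_sum_type, Finset.sum_add_distrib]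
    rfl
  have le_of_lt_index : ∀ i j, i < j →
      w (p i) (p j) + w (p i) (q j) + (w (q i) (p j) + w (q i) (q j)) ≤
        4 * w (p i) (q i) := by
    intro i j hij
    obtain ⟨h₁, h₂, h₃, h₄⟩ := hgreedy i j hij
    linarith
  have slack : ∀ i j, 0 ≤ w (p j) (q j) - w (p i) (q i) * w (p j) (q j) / wstar := by
    intro i j
    rw [sub_nonneg, div_le_iff₀ hwstar, mul_comm]
    exact mul_le_mul_of_nonneg_left (hub i) (hnonneg _ _)
  have block_le : ∀ i j,
      w (p i) (p j) + w (p i) (q j) + (w (q i) (p j) + w (q i) (q j)) ≤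
        4 * (w (p i) (q i) + w (p j) (q j) - w (p i) (q i) * w (p j) (q j) / wstar) := by
    intro i j
    have hs := slack i j
    rcases lt_trichotomy i j with hij | rfl | hij
    · linarith [le_of_lt_index i j hij]
    · linarith [hzero (p i), hzero (q i), hsymm (p i) (q i), hnonneg (p i) (q i)]
    · have hs' := slack j i
      rw [mul_comm] at hs'
      linarith [le_of_lt_index j i hij, hsymm (p i) (p j), hsymm (p i) (q j),
        hsymm (q i) (p j), hsymm (q i) (q j)]
  have total_le : ∑ x : V, ∑ y : V, w x y ≤ ∑ i, ∑ j,
      4 * (w (p i) (q i) + w (p j) (q j) - w (p i) (q i) * w (p j) (q j) / wstar) := by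
    simp only [sum_split, ← Finset.sum_add_distrib]
    exact Finset.sum_le_sum fun i _ => Finset.sum_le_sum fun j _ => block_le i j
  have total_eq : ∑ i, ∑ j,
      4 * (w (p i) (q i) + w (p j) (q j) - w (p i) (q i) * w (p j) (q j) / wstar) =
        4 * (m * W + m * W - W * W / wstar) := by
    simp only [← Finset.mul_sum, Finset.sum_sub_distrib, Finset.sum_add_distrib,
      ← Finset.sum_div, ← Finset.sum_mul, ← hW, Finset.sum_const, Finset.card_univ,
      Fintype.card_fin, nsmul_eq_mul]
  rw [total_eq] at total_le
  have hn' : (n : ℝ) = 2 * m := by exact_mod_cast hn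
  rw [hn']
  calc (1 / 2) * ∑ x : V, ∑ y : V, w x y
      ≤ (1 / 2) * (4 * (m * W + m * W - W * W / wstar)) := by gcongr
    _ = 2 * W * (2 * m - W / wstar) := by ring
end

section
/- Let T be a finite set with |T| = n = 2m, let e₁ = {x₁,y₁}, …, e_m = {x_m,y_m} be a perfect matching on T in greedy order with weights wᵢ = w(xᵢ,yᵢ) and total weight W = Σᵢ₌₁^m wᵢ, and let x ∈ [0, 1/4] be such that xn is an integer and the total weight of the top xn edges satisfies Σᵢ₌₁^{xn} wᵢ ≤ W/2. Then (1/n)·w(T) ≤ 2·W·(1 − 2x), where w(T) is the sum of w over all unordered pairs of distinct elements of T. -/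
/-- Abel summation: if all partial sums of `a` are nonnegative and `f` is antitone and
nonnegative, then `∑ f i * a i` is nonnegative. -/
theorem sum_mul_nonneg_of_antitone {f a : ℕ → ℝ} (hf : Antitone f) (hf0 : ∀ i, 0 ≤ f i)
    (ha : ∀ k, 0 ≤ ∑ i ∈ Finset.range k, a i) (k : ℕ) :
    0 ≤ ∑ i ∈ Finset.range k, f i * a i := by
  have key : f k * ∑ i ∈ Finset.range k, a i ≤ ∑ i ∈ Finset.range k, f i * a i := by
    induction k with
    | zero => simp
    | succ k ih =>
      have h := mul_le_mul_of_nonneg_right (hf (Nat.le_succ k)) (ha (k + 1))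
      rw [Finset.sum_range_succ] at h ⊢
      rw [Finset.sum_range_succ]
      linarith
  exact (mul_nonneg (hf0 k) (ha k)).trans key

theorem sum_range_shifted_nonneg (s k : ℕ) :
    0 ≤ ∑ i ∈ Finset.range k, ((i : ℝ) + 3 / 4 - if i < s then 0 else 2 * (s : ℝ)) := by
  have key : ∑ i ∈ Finset.range k, ((i : ℝ) + 3 / 4 - if i < s then 0 else 2 * (s : ℝ)) =
      (k : ℝ) ^ 2 / 2 + k / 4 - if k < s then 0 else 2 * (s : ℝ) * (k - s) := by
    induction k with
    | zero =>
      rcases Nat.eq_zero_or_pos s with rfl | h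
      · simp
      · simp [h]
    | succ k ih =>
      rw [Finset.sum_range_succ, ih]
      rcases lt_trichotomy (k + 1) s with h | h | h
      · rw [if_pos h, if_pos (by omega), if_pos (by omega)]
        push_cast
        ring
      · subst h
        simp
        ring
      · rw [if_neg (by omega), if_neg (by omega), if_neg (by omega)]
        push_cast
        ring
  rw [key]
  have hk : (0 : ℝ) ≤ k := Nat.cast_nonneg k
  split_ifs
  · rw [sub_zero]
    positivity
  · nlinarith [sq_nonneg ((k : ℝ) - 2 * s)]

theorem sum_range_sum_range_min (f : ℕ → ℝ) (m : ℕ) :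
    ∑ i ∈ Finset.range m, ∑ j ∈ Finset.range m, f (min i j) =
      ∑ i ∈ Finset.range m, f i * (2 * ((m : ℝ) - i) - 1) := by
  induction m with
  | zero => simp
  | succ m ih =>
    have h1 : ∀ i ∈ Finset.range m, f (min i m) = f i := fun i hi => by
      rw [min_eq_left (Finset.mem_range.1 hi).le]
    have h2 : ∀ i ∈ Finset.range m, f (min m i) = f i := fun i hi => by
      rw [min_eq_right (Finset.mem_range.1 hi).le]
    simp only [Finset.sum_range_succ, Finset.sum_add_distrib, ih, Finset.sum_congr rfl h1,
      Finset.sum_congr rfl h2, min_self]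
    have h3 : ∑ i ∈ Finset.range m, f i * (2 * (((m + 1 : ℕ) : ℝ) - i) - 1) =
        ∑ i ∈ Finset.range m, f i * (2 * ((m : ℝ) - i) - 1) +
          2 * ∑ i ∈ Finset.range m, f i := by
      rw [Finset.mul_sum, ← Finset.sum_add_distrib]
      refine Finset.sum_congr rfl fun i _ => ?_
      push_cast
      ring
    rw [h3]
    push_cast
    ring

/-- If the first `s` terms of a nonnegative antitone sequence carry at most half of the total
weight, the weighted mean of `i + 3 / 4` is at least `s`. -/
theorem mul_sum_le_sum_mul_of_antitone {f : ℕ → ℝ} (hf : Antitone f) (hf0 : ∀ i, 0 ≤ f i)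
    (m s : ℕ)
    (htop : ∑ i ∈ (Finset.range m).filter (· < s), f i ≤ (∑ i ∈ Finset.range m, f i) / 2) :
    s * ∑ i ∈ Finset.range m, f i ≤ ∑ i ∈ Finset.range m, f i * ((i : ℝ) + 3 / 4) := by
  have h := sum_mul_nonneg_of_antitone hf hf0 (sum_range_shifted_nonneg s) m
  have e : ∑ i ∈ Finset.range m, f i * ((i : ℝ) + 3 / 4 - if i < s then 0 else 2 * (s : ℝ)) =
      ∑ i ∈ Finset.range m, f i * ((i : ℝ) + 3 / 4) - 2 * s * ∑ i ∈ Finset.range m, f i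
        + 2 * s * ∑ i ∈ (Finset.range m).filter (· < s), f i := by
    rw [Finset.sum_filter, Finset.mul_sum, Finset.mul_sum, ← Finset.sum_sub_distrib,
      ← Finset.sum_add_distrib]
    refine Finset.sum_congr rfl fun i _ => ?_
    split_ifs <;> ring
  rw [e] at h
  have := mul_le_mul_of_nonneg_left htop (Nat.cast_nonneg (α := ℝ) s)
  linarith

/-- A perfect matching groups the double sum over vertices into blocks indexed by pairs of
edges. -/
theorem sum_sum_eq_sum_matching {V : Type*} [Fintype V] {m : ℕ} (w : V → V → ℝ)
    {p q : Fin m → V} (hp : Function.Injective p) (hq : Function.Injective q)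
    (hpq : ∀ i j, p i ≠ q j) (hcover : ∀ v : V, (∃ i, p i = v) ∨ (∃ i, q i = v)) :
    ∑ a, ∑ b, w a b = ∑ i, ∑ j, (w (p i) (p j) + w (p i) (q j) + w (q i) (p j) +
      w (q i) (q j)) := by
  have hb : Function.Bijective (Sum.elim p q) := by
    refine ⟨hp.sumElim hq hpq, fun v => ?_⟩
    rcases hcover v with ⟨i, hi⟩ | ⟨i, hi⟩
    · exact ⟨Sum.inl i, hi⟩
    · exact ⟨Sum.inr i, hi⟩
  have hsum : ∀ g : V → ℝ, ∑ a, g a = ∑ i, g (p i) + ∑ i, g (q i) := fun g => by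
    rw [← hb.sum_comp g, Fintype.sum_sum_type]
    rfl
  simp only [hsum, Finset.sum_add_distrib]
  ring


/-- if `e₁,…,e_m` is a perfect matching on `T` (`|T| = n = 2m`) in greedy
order with total weight `W`, `x ∈ [0, 1/4]`, `xn` is an integer `s`, and the top `s`
edges weigh at most `W/2`, then `(1/n)·w(T) ≤ 2·W·(1 − 2x)`. -/
theorem stmt8 {V : Type*} [Fintype V] [DecidableEq V]
    (w : V → V → ℝ)
    (hsymm : ∀ x y, w x y = w y x)
    (hnonneg : ∀ x y, 0 ≤ w x y)
    (hzero : ∀ x, w x x = 0)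
    (m n : ℕ) (hn : n = 2 * m) (hcard : Fintype.card V = n)
    (p q : Fin m → V)
    (hp : Function.Injective p) (hq : Function.Injective q)
    (hpq : ∀ i j, p i ≠ q j)
    (hcover : ∀ v : V, (∃ i, p i = v) ∨ (∃ i, q i = v))
    (hsorted : ∀ i j : Fin m, i ≤ j → w (p j) (q j) ≤ w (p i) (q i))
    (hgreedy : ∀ i j : Fin m, i < j →
      w (p i) (p j) ≤ w (p i) (q i) ∧ w (p i) (q j) ≤ w (p i) (q i) ∧
      w (q i) (p j) ≤ w (p i) (q i) ∧ w (q i) (q j) ≤ w (p i) (q i))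
    (W : ℝ) (hW : W = ∑ i, w (p i) (q i))
    (x : ℝ) (hx0 : 0 ≤ x) (hx1 : x ≤ 1/4)
    (s : ℕ) (hs : (s : ℝ) = x * n)
    (htop : ∑ i ∈ Finset.univ.filter (fun i : Fin m => (i : ℕ) < s), w (p i) (q i)
      ≤ W / 2) :
    (1 / (n : ℝ)) * ((1/2) * ∑ a : V, ∑ b : V, w a b) ≤ 2 * W * (1 - 2 * x) := by
  rcases Nat.eq_zero_or_pos m with rfl | hm
  · subst hn hW
    simp
  set f : ℕ → ℝ := fun i => if h : i < m then w (p ⟨i, h⟩) (q ⟨i, h⟩) else 0 with hfdef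
  have hfv : ∀ i : Fin m, f i = w (p i) (q i) := fun i => by simp [hfdef]
  have hf0 : ∀ i, 0 ≤ f i := fun i => by
    simp only [hfdef]
    split_ifs
    · exact hnonneg _ _
    · exact le_rfl
  have hf : Antitone f := fun i j hij => by
    by_cases hj : j < m
    · simpa [hfdef, hj, hij.trans_lt hj] using hsorted ⟨i, hij.trans_lt hj⟩ ⟨j, hj⟩ hij
    · simpa [hfdef, hj] using hf0 i
  have hWf : W = ∑ i ∈ Finset.range m, f i := by
    rw [hW, Finset.sum_range]
    simp only [hfv]
  have htop' : ∑ i ∈ (Finset.range m).filter (· < s), f i ≤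
      (∑ i ∈ Finset.range m, f i) / 2 := by
    rw [← hWf]
    refine le_of_eq_of_le ?_ htop
    rw [Finset.sum_filter, Finset.sum_filter, Finset.sum_range]
    simp only [hfv]
  have hmean := mul_sum_le_sum_mul_of_antitone hf hf0 m s htop'
  have hblock : ∀ i j : Fin m, w (p i) (p j) + w (p i) (q j) + w (q i) (p j) + w (q i) (q j) ≤
      4 * f (min (i : ℕ) j) - if i = j then 2 * f i else 0 := fun i j => by
    rcases lt_trichotomy i j with h | rfl | h
    · obtain ⟨h1, h2, h3, h4⟩ := hgreedy i j h
      rw [if_neg h.ne, min_eq_left (Fin.le_def.1 h.le), hfv]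
      linarith
    · rw [if_pos rfl, min_self, hfv, hzero, hzero, hsymm (q i) (p i)]
      linarith
    · obtain ⟨h1, h2, h3, h4⟩ := hgreedy j i h
      rw [if_neg h.ne', min_eq_right (Fin.le_def.1 h.le), hfv, hsymm (p i) (p j),
        hsymm (p i) (q j), hsymm (q i) (p j), hsymm (q i) (q j)]
      linarith
  have htotal : ∑ a, ∑ b, w a b ≤
      4 * ∑ i ∈ Finset.range m, f i * (2 * ((m : ℝ) - i) - 1) - 2 * W := by
    rw [sum_sum_eq_sum_matching w hp hq hpq hcover]
    refine (Finset.sum_le_sum fun i _ => Finset.sum_le_sum fun j _ => hblock i j).trans_eq ?_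
    rw [← sum_range_sum_range_min, hWf]
    simp only [Finset.sum_sub_distrib, Finset.sum_ite_eq, Finset.mem_univ, if_true,
      Finset.sum_range, Finset.mul_sum]
  have hexp : 4 * ∑ i ∈ Finset.range m, f i * (2 * ((m : ℝ) - i) - 1) =
      (8 * m + 2) * W - 8 * ∑ i ∈ Finset.range m, f i * ((i : ℝ) + 3 / 4) := by
    rw [hWf, Finset.mul_sum, Finset.mul_sum, Finset.mul_sum, ← Finset.sum_sub_distrib]
    refine Finset.sum_congr rfl fun i _ => ?_
    ring
  rw [← hWf, hs] at hmean
  have hn0 : (0 : ℝ) < n := by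
    rw [hn]
    exact_mod_cast (by omega : 0 < 2 * m)
  have hnm : (n : ℝ) = 2 * m := by
    rw [hn]
    push_cast
    rfl
  rw [one_div, inv_mul_le_iff₀ hn0]
  have hr : (n : ℝ) * (2 * W * (1 - 2 * x)) = 4 * m * W - 4 * (x * n * W) := by
    rw [hnm]
    ring
  rw [hr]
  linarith
end

section
/- Let S be a finite set with |S| ≥ 2r for an integer r ≥ 1, and for every i ∈ S let sᵢ ∈ S∖{i} be an element maximizing w(i,·) over S∖{i}. Then |S|·OPT(S,r) ≤ Σ_{i∈S} OPT(S∖{i,sᵢ}, r−1) + 2·Σ_{i∈S} w(i,sᵢ), where OPT(A,t) denotes the maximum total weight of a matching consisting of exactly t pairwise disjoint unordered pairs of distinct elements of A. -/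
/-- `M` is a matching of exactly `t` pairwise disjoint pairs of distinct elements of `A`;
each unordered pair is represented by an ordered pair listed once. -/
def IsMatchingOn {V : Type*} (A : Finset V) (t : ℕ) (M : Finset (V × V)) : Prop :=
  M.card = t ∧
  (∀ e ∈ M, e.1 ≠ e.2 ∧ e.1 ∈ A ∧ e.2 ∈ A) ∧
  (∀ e ∈ M, ∀ f ∈ M, e ≠ f →
    e.1 ≠ f.1 ∧ e.1 ≠ f.2 ∧ e.2 ≠ f.1 ∧ e.2 ≠ f.2)

theorem IsMatchingOn.exists_partner {V : Type*} {A : Finset V} {t : ℕ} {M : Finset (V × V)}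
    (hM : IsMatchingOn A t M) :
    ∃ p : V → V, (∀ x, p (p x) = x) ∧ (∀ x ∈ A, p x ∈ A) ∧
      (∀ x, p x ≠ x → ∃ e ∈ M, e = (x, p x) ∨ e = (p x, x)) ∧
      (∀ e ∈ M, p e.1 = e.2 ∧ p e.2 = e.1) := by
  classical
  obtain ⟨-, hA, hdisj⟩ := hM
  let R : V → V → Prop := fun x y => (x, y) ∈ M ∨ (y, x) ∈ M
  have hsymm : ∀ x y, R x y → R y x := fun x y h => h.symm
  have huniq : ∀ x y z, R x y → R x z → y = z := by
    rintro x y z (hy | hy) (hz | hz) <;> by_contra hne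
    · exact (hdisj _ hy _ hz (by grind)).1 rfl
    · have := (hA _ hy).1
      exact (hdisj _ hy _ hz (by grind)).2.1 rfl
    · have := (hA _ hy).1
      exact (hdisj _ hy _ hz (by grind)).2.2.1 rfl
    · exact (hdisj _ hy _ hz (by grind)).2.2.2 rfl
  let p : V → V := fun x => if h : ∃ y, R x y then h.choose else x
  have hpR : ∀ x y, R x y → p x = y := by
    intro x y h
    have hex : ∃ y, R x y := ⟨y, h⟩
    have hp : p x = hex.choose := dif_pos hex
    exact hp.trans (huniq x _ _ hex.choose_spec h)
  have hp_self : ∀ x, (¬ ∃ y, R x y) → p x = x := fun x h => dif_neg h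
  refine ⟨p, fun x => ?_, fun x hx => ?_, fun x hx => ?_, fun e he => ?_⟩
  · by_cases h : ∃ y, R x y
    · obtain ⟨y, hy⟩ := h
      rw [hpR x y hy, hpR y x (hsymm x y hy)]
    · rw [hp_self x h, hp_self x h]
  · by_cases h : ∃ y, R x y
    · obtain ⟨y, hy⟩ := h
      rw [hpR x y hy]
      rcases hy with hy | hy
      · exact (hA _ hy).2.2
      · exact (hA _ hy).2.1
    · rwa [hp_self x h]
  · by_cases h : ∃ y, R x y
    · obtain ⟨y, hy⟩ := h
      rw [hpR x y hy]
      rcases hy with hy | hy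
      · exact ⟨_, hy, Or.inl rfl⟩
      · exact ⟨_, hy, Or.inr rfl⟩
    · exact absurd (hp_self x h) hx
  · exact ⟨hpR _ _ (Or.inl he), hpR _ _ (Or.inr he)⟩

theorem IsMatchingOn.erase {V : Type*} [DecidableEq V] {A : Finset V} {t : ℕ}
    {M : Finset (V × V)} (hM : IsMatchingOn A t M) {e : V × V} (he : e ∈ M) {a b : V}
    (hab : ∀ f ∈ M, f ≠ e → f.1 ≠ a ∧ f.1 ≠ b ∧ f.2 ≠ a ∧ f.2 ≠ b) :
    IsMatchingOn (A \ {a, b}) (t - 1) (M.erase e) := by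
  obtain ⟨hcard, hA, hdisj⟩ := hM
  refine ⟨by rw [Finset.card_erase_of_mem he, hcard], fun f hf => ?_, fun f hf g hg => ?_⟩
  · obtain ⟨hne, hf⟩ := Finset.mem_erase.1 hf
    have h₁ := hA f hf
    have h₂ := hab f hf hne
    simp only [Finset.mem_sdiff, Finset.mem_insert, Finset.mem_singleton]
    tauto
  · exact hdisj f (Finset.mem_of_mem_erase hf) g (Finset.mem_of_mem_erase hg)

/-- Replacing the edges `{a, c}` and `{b, d}` of a matching by the edge `{c, d}`. -/
theorem IsMatchingOn.swap {V : Type*} [DecidableEq V] {A : Finset V} {t : ℕ}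
    {M : Finset (V × V)} (hM : IsMatchingOn A t M) {a b c d : V} {e f : V × V}
    (he : e ∈ M) (hf : f ∈ M) (hef : e ≠ f)
    (hac : e = (a, c) ∨ e = (c, a)) (hbd : f = (b, d) ∨ f = (d, b)) :
    (c, d) ∉ (M.erase e).erase f ∧
      IsMatchingOn (A \ {a, b}) (t - 1) (insert (c, d) ((M.erase e).erase f)) := by
  obtain ⟨hcard, hA, hdisj⟩ := hM
  have hfe : f ∈ M.erase e := Finset.mem_erase.2 ⟨hef.symm, hf⟩
  have hAe := hA e he
  have hAf := hA f hf
  have hd := hdisj e he f hf hef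
  have hrest : ∀ g ∈ (M.erase e).erase f, g ∈ M ∧
      (g.1 ≠ a ∧ g.1 ≠ b ∧ g.1 ≠ c ∧ g.1 ≠ d) ∧ g.2 ≠ a ∧ g.2 ≠ b ∧ g.2 ≠ c ∧ g.2 ≠ d := by
    intro g hg
    simp only [Finset.mem_erase] at hg
    have h₁ := hdisj g hg.2.2 e he hg.2.1
    have h₂ := hdisj g hg.2.2 f hf hg.1
    refine ⟨hg.2.2, ?_⟩
    rcases hac with rfl | rfl <;> rcases hbd with rfl | rfl <;> tauto
  have hnew : (c ≠ d ∧ c ≠ a ∧ c ≠ b ∧ d ≠ a ∧ d ≠ b) ∧ c ∈ A ∧ d ∈ A := by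
    rcases hac with rfl | rfl <;> rcases hbd with rfl | rfl <;> grind
  have hnot : (c, d) ∉ (M.erase e).erase f := fun h => (hrest _ h).2.1.2.2.1 rfl
  refine ⟨hnot, ?_, fun g hg => ?_, fun g hg h hh hgh => ?_⟩
  · have hpos : 0 < (M.erase e).card := Finset.card_pos.2 ⟨f, hfe⟩
    rw [Finset.card_insert_of_notMem hnot, Finset.card_erase_of_mem hfe]
    rw [Finset.card_erase_of_mem he] at hpos ⊢
    omega
  · simp only [Finset.mem_sdiff, Finset.mem_insert (s := {b}), Finset.mem_singleton]
    rcases Finset.mem_insert.1 hg with rfl | hg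
    · tauto
    · have h₁ := hrest g hg
      have h₂ := hA g h₁.1
      tauto
  · rcases Finset.mem_insert.1 hg with rfl | hg <;> rcases Finset.mem_insert.1 hh with rfl | hh
    · exact absurd rfl hgh
    · have := (hrest h hh).2
      exact ⟨this.1.2.2.1.symm, this.2.2.2.1.symm, this.1.2.2.2.symm, this.2.2.2.2.symm⟩
    · have := (hrest g hg).2
      exact ⟨this.1.2.2.1, this.1.2.2.2, this.2.2.2.1, this.2.2.2.2⟩
    · exact hdisj g (hrest g hg).1 h (hrest h hh).1 hgh

/-- the key structural claim for random serial dictatorship: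
`|S|·OPT(S,r) ≤ ∑_{i∈S} OPT(S∖{i,sᵢ}, r−1) + 2·∑_{i∈S} w(i,sᵢ)`, where `sᵢ`
maximizes `w(i,·)` over `S∖{i}` and `OPT(A,t)` is the maximum weight of a `t`-matching
in `A`. -/
theorem stmt9 {V : Type*} [DecidableEq V]
    (w : V → V → ℝ)
    (hsymm : ∀ x y, w x y = w y x)
    (hnonneg : ∀ x y, 0 ≤ w x y)
    (hzero : ∀ x, w x x = 0)
    (htri : ∀ x y z, w x z ≤ w x y + w y z)
    (OPT : Finset V → ℕ → ℝ)
    (hub : ∀ (A : Finset V) (t : ℕ) (M : Finset (V × V)), IsMatchingOn A t M →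
      ∑ e ∈ M, w e.1 e.2 ≤ OPT A t)
    (hach : ∀ (A : Finset V) (t : ℕ), 2 * t ≤ A.card →
      ∃ M : Finset (V × V), IsMatchingOn A t M ∧ ∑ e ∈ M, w e.1 e.2 = OPT A t)
    (S : Finset V) (r : ℕ) (hr : 1 ≤ r) (hS : 2 * r ≤ S.card)
    (s : V → V)
    (hs_mem : ∀ i ∈ S, s i ∈ S)
    (hs_ne : ∀ i ∈ S, s i ≠ i)
    (hs_max : ∀ i ∈ S, ∀ j ∈ S, j ≠ i → w i j ≤ w i (s i)) :
    (S.card : ℝ) * OPT S r ≤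
      (∑ i ∈ S, OPT (S \ {i, s i}) (r - 1)) + 2 * ∑ i ∈ S, w i (s i) := by
  obtain ⟨M, hM, hMw⟩ := hach S r hS
  obtain ⟨p, hpp, hpS, hpM, hMp⟩ := hM.exists_partner
  have hwS : ∀ i ∈ S, ∀ j ∈ S, w i j ≤ w i (s i) := by
    intro i hi j hj
    by_cases hij : j = i
    · rw [hij, hzero]
      exact hnonneg _ _
    · exact hs_max i hi j hj hij
  have hw_edge : ∀ e : V × V, ∀ x y, e = (x, y) ∨ e = (y, x) → w e.1 e.2 = w x y := by
    rintro e x y (rfl | rfl)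
    · rfl
    · exact hsymm _ _
  have herase : ∀ i, ∀ e ∈ M,
      (∀ f ∈ M, f ≠ e → f.1 ≠ i ∧ f.1 ≠ s i ∧ f.2 ≠ i ∧ f.2 ≠ s i) →
      OPT S r ≤ OPT (S \ {i, s i}) (r - 1) + w e.1 e.2 := by
    intro i e he hav
    have h := hub _ _ _ (hM.erase he hav)
    have hsum := Finset.sum_erase_add M (fun e => w e.1 e.2) he
    linarith
  have hloss : ∀ i ∈ S,
      OPT S r ≤ OPT (S \ {i, s i}) (r - 1) + (w i (s i) + w (p i) (s (p i))) := by
    intro i hi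
    have hvia : ∀ x ∈ S, ∀ y ∈ S, w x y ≤ w i (s i) + w i (s i) := by
      intro x hx y hy
      have := htri x i y
      have := hsymm x i
      have := hwS i hi x hx
      have := hwS i hi y hy
      linarith
    by_cases hpi : p i = i
    · rw [hpi]
      by_cases hps : p (s i) = s i
      · obtain ⟨e, he⟩ : M.Nonempty := Finset.card_pos.1 (by have := hM.1; omega)
        have h := herase i e he (fun f hf _ => by
          have := hMp f hf
          have := hM.2.1 f hf
          grind)
        have := hvia e.1 (hM.2.1 e he).2.1 e.2 (hM.2.1 e he).2.2
        linarith
      · obtain ⟨e, he, hes⟩ := hpM (s i) hps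
        have h := herase i e he (fun f hf hfe => by
          have := hMp f hf
          have := hM.2.1 f hf
          have := hM.2.2 f hf e he hfe
          grind)
        have := hvia e.1 (hM.2.1 e he).2.1 e.2 (hM.2.1 e he).2.2
        linarith
    · obtain ⟨e, he, hei⟩ := hpM i hpi
      have hwe := hw_edge e i (p i) hei
      have hwi := hwS i hi (p i) (hpS i hi)
      have hnn := hnonneg (p i) (s (p i))
      by_cases hps : p (s i) = s i ∨ p i = s i
      · have h := herase i e he (fun f hf hfe => by
          have := hMp f hf
          have := hM.2.1 f hf
          have := hM.2.2 f hf e he hfe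
          grind)
        linarith
      · push Not at hps
        obtain ⟨f, hf, hfs⟩ := hpM (s i) hps.1
        have hef : e ≠ f := by
          have := hs_ne i hi
          rintro rfl
          grind
        have hwf := hw_edge f (s i) (p (s i)) hfs
        obtain ⟨hnot, hM'⟩ := hM.swap he hf hef hei hfs
        have h := hub _ _ _ hM'
        rw [Finset.sum_insert hnot] at h
        have hsum := Finset.sum_erase_add M (fun e => w e.1 e.2) he
        have hsum' := Finset.sum_erase_add (M.erase e) (fun e => w e.1 e.2)
          (Finset.mem_erase.2 ⟨hef.symm, hf⟩)
        simp only at h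
        have := htri (s i) (p i) (p (s i))
        have := hsymm (s i) (p i)
        have := hwS (p i) (hpS i hi) (s i) (hs_mem i hi)
        linarith
  have hreindex : ∑ i ∈ S, w (p i) (s (p i)) = ∑ i ∈ S, w i (s i) :=
    Finset.sum_nbij' p p hpS hpS (fun i _ => hpp i) (fun i _ => hpp i) (fun _ _ => rfl)
  have hsum := Finset.sum_le_sum hloss
  rw [Finset.sum_const, nsmul_eq_mul, Finset.sum_add_distrib, Finset.sum_add_distrib,
    hreindex] at hsum
  linarith
end

section
/- Let T be a finite set of nodes with |T| ≥ 2 and let x be any node. Then Σ_{t∈T} w(x,t) ≥ (1/(|T|−1))·w(T), where w(T) denotes the sum of w(i,j) over unordered pairs {i,j} of distinct elements of T. -/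
/-- for a finite set `T` with `|T| ≥ 2` and any node `x`,
`∑_{t∈T} w(x,t) ≥ (1/(|T|−1))·w(T)`, where `w(T) = (1/2)∑_{i,j∈T} w(i,j)`. -/
theorem stmt11 {V : Type*} [DecidableEq V]
    (w : V → V → ℝ)
    (hsymm : ∀ x y, w x y = w y x)
    (hnonneg : ∀ x y, 0 ≤ w x y)
    (hzero : ∀ x, w x x = 0)
    (htri : ∀ x y z, w x z ≤ w x y + w y z)
    (T : Finset V) (hT : 2 ≤ T.card) (x : V) :
    (1 / ((T.card : ℝ) - 1)) * ((1/2) * ∑ i ∈ T, ∑ j ∈ T, w i j) ≤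
      ∑ t ∈ T, w x t := by
  have hpair : ∀ i j, w i j ≤ w x i + w x j - if i = j then 2 * w x i else 0 := by
    intro i j
    split_ifs with h
    · subst h
      linarith [hzero i]
    · linarith [htri i x j, hsymm i x]
  have hsum : ∑ i ∈ T, ∑ j ∈ T, w i j ≤ 2 * ((T.card : ℝ) - 1) * ∑ t ∈ T, w x t := by
    calc ∑ i ∈ T, ∑ j ∈ T, w i j
        ≤ ∑ i ∈ T, ∑ j ∈ T, (w x i + w x j - if i = j then 2 * w x i else 0) :=
          Finset.sum_le_sum fun i _ => Finset.sum_le_sum fun j _ => hpair i j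
      _ = ∑ i ∈ T, (T.card * w x i + ∑ t ∈ T, w x t - 2 * w x i) := by
          refine Finset.sum_congr rfl fun i hi => ?_
          simp [Finset.sum_sub_distrib, Finset.sum_add_distrib, hi]
      _ = 2 * ((T.card : ℝ) - 1) * ∑ t ∈ T, w x t := by
          simp only [Finset.sum_sub_distrib, Finset.sum_add_distrib, ← Finset.mul_sum,
            Finset.sum_const, nsmul_eq_mul]
          ring
  have hcard : (0 : ℝ) < T.card - 1 := by
    have : (2 : ℝ) ≤ T.card := by exact_mod_cast hT
    linarith
  rw [one_div_mul_eq_div, div_le_iff₀ hcard]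
  linarith
end

section
/- For every integer r with 2 ≤ r ≤ |V| − 1, the optimum values of the densest subgraph problem satisfy OPT_{r+1} ≤ OPT_r + (2/(r−1))·OPT_r, where OPT_t denotes the maximum, over all subsets S ⊆ V with |S| = t, of the sum of w over unordered pairs of distinct elements of S. -/
/-- Deleting a vertex `v` from `S` removes its row and its column from the double sum. -/
lemma Finset.sum_sum_erase_of_symm {V : Type*} [DecidableEq V] {w : V → V → ℝ}
    (hsymm : ∀ x y, w x y = w y x) (hzero : ∀ x, w x x = 0) {S : Finset V} {v : V}
    (hv : v ∈ S) :
    ∑ x ∈ S.erase v, ∑ y ∈ S.erase v, w x y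
      = ∑ x ∈ S, ∑ y ∈ S, w x y - 2 * ∑ y ∈ S, w v y := by
  simp only [Finset.sum_erase_eq_sub hv, Finset.sum_sub_distrib, hzero, hsymm _ v]
  ring

/-- Averaging over all deletions of a vertex: every pair survives `S.card - 2` of them. -/
lemma Finset.sum_sum_sum_erase_of_symm {V : Type*} [DecidableEq V] {w : V → V → ℝ}
    (hsymm : ∀ x y, w x y = w y x) (hzero : ∀ x, w x x = 0) (S : Finset V) :
    ∑ v ∈ S, ∑ x ∈ S.erase v, ∑ y ∈ S.erase v, w x y
      = ((S.card : ℝ) - 2) * ∑ x ∈ S, ∑ y ∈ S, w x y := by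
  rw [Finset.sum_congr rfl fun v hv => Finset.sum_sum_erase_of_symm hsymm hzero hv,
    Finset.sum_sub_distrib, ← Finset.mul_sum, Finset.sum_const, nsmul_eq_mul]
  ring

/-- if `OPT t` is the maximum, over subsets `S ⊆ V` of size `t`, of the
total weight of pairs inside `S`, then for every `2 ≤ r ≤ |V| − 1`,
`OPT (r+1) ≤ OPT r + (2/(r−1))·OPT r`. -/
theorem stmt12 {V : Type*} [Fintype V] [DecidableEq V]
    (w : V → V → ℝ)
    (hsymm : ∀ x y, w x y = w y x)
    (hnonneg : ∀ x y, 0 ≤ w x y)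
    (hzero : ∀ x, w x x = 0)
    (OPT : ℕ → ℝ)
    (hub : ∀ t : ℕ, t ≤ Fintype.card V → ∀ S : Finset V, S.card = t →
      (1/2) * ∑ x ∈ S, ∑ y ∈ S, w x y ≤ OPT t)
    (hach : ∀ t : ℕ, t ≤ Fintype.card V →
      ∃ S : Finset V, S.card = t ∧ (1/2) * ∑ x ∈ S, ∑ y ∈ S, w x y = OPT t)
    (r : ℕ) (hr2 : 2 ≤ r) (hr : r + 1 ≤ Fintype.card V) :
    OPT (r + 1) ≤ OPT r + (2 / ((r : ℝ) - 1)) * OPT r := by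
  obtain ⟨S, hcard, hS⟩ := hach (r + 1) hr
  have hsum := Finset.sum_le_card_nsmul S
    (fun v => (1/2) * ∑ x ∈ S.erase v, ∑ y ∈ S.erase v, w x y) (OPT r) fun v hv =>
      hub r (by omega) (S.erase v) (by rw [Finset.card_erase_of_mem hv, hcard]; rfl)
  rw [← Finset.mul_sum, Finset.sum_sum_sum_erase_of_symm hsymm hzero, nsmul_eq_mul, hcard]
    at hsum
  push_cast at hsum
  have hr' : (0 : ℝ) < (r : ℝ) - 1 := by
    have : (2 : ℝ) ≤ r := by exact_mod_cast hr2
    linarith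
  have hfactor : OPT r + (2 / ((r : ℝ) - 1)) * OPT r = ((r : ℝ) + 1) * OPT r / ((r : ℝ) - 1) := by
    field_simp
    ring
  rw [hfactor, le_div_iff₀ hr', ← hS]
  linarith
end

section
/- Let |V| ≥ 3, let a and x be two distinct elements of V, and let b ∈ V∖{a,x} be an element maximizing w(a,·) over V∖{a,x}. Then w(a,x) + w(b,x) ≥ (1/2)·w*_max, where w*_max = max_{i,j∈V} w(i,j) is the maximum weight of any pair in V. -/
/-- if `a ≠ x`, `b` maximizes `w(a,·)` over `V∖{a,x}`, and `w*_max` is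
the maximum weight of any pair, then `w(a,x) + w(b,x) ≥ (1/2)·w*_max`. -/
theorem stmt13 {V : Type*} [Fintype V] [DecidableEq V]
    (w : V → V → ℝ)
    (hsymm : ∀ x y, w x y = w y x)
    (hnonneg : ∀ x y, 0 ≤ w x y)
    (hzero : ∀ x, w x x = 0)
    (htri : ∀ x y z, w x z ≤ w x y + w y z)
    (hV : 3 ≤ Fintype.card V)
    (a x : V) (hax : a ≠ x)
    (b : V) (hba : b ≠ a) (hbx : b ≠ x)
    (hbmax : ∀ c : V, c ≠ a → c ≠ x → w a c ≤ w a b)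
    (wmax : ℝ)
    (hub : ∀ i j : V, w i j ≤ wmax)
    (hach : ∃ i j : V, w i j = wmax) :
    (1/2) * wmax ≤ w a x + w b x := by
  have hS : ∀ c, w a c ≤ w a x + w b x := by
    intro c
    by_cases hca : c = a
    · rw [hca, hzero]
      exact add_nonneg (hnonneg a x) (hnonneg b x)
    by_cases hcx : c = x
    · rw [hcx]
      linarith [hnonneg b x]
    · linarith [hbmax c hca hcx, htri a x b, hsymm x b]
  obtain ⟨i, j, hij⟩ := hach
  linarith [htri i a j, hsymm i a, hS i, hS j]
end

section
/- Let S̄ ⊆ V, let a ∈ V∖S̄, let b ∈ V∖(S̄ ∪ {a}) be an element maximizing w(a,·) over V∖(S̄ ∪ {a}), and set w*_a = w(a,b). Let T ⊆ V and let p, q ∈ V∖S̄. Then: (1) Σ_{j∈T} w(p,j) ≤ Σ_{j∈T∩S̄} w(a,j) + |T∩S̄|·w*_a + 2·|T∖S̄|·w*_a; and (2) Σ_{j∈T} w(q,j) ≤ Σ_{j∈T∩S̄} w(b,j) + 2·|T∩S̄|·w*_a + 2·|T∖S̄|·w*_a. -/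
/-- the charging lemma for Densest k-Subgraph. With `a ∉ S̄`, `b` the
maximizer of `w(a,·)` over `V∖(S̄∪{a})`, `w*_a = w(a,b)`, `T ⊆ V`, and `p,q ∉ S̄`:
(1) `∑_{j∈T} w(p,j) ≤ ∑_{j∈T∩S̄} w(a,j) + |T∩S̄|·w*_a + 2|T∖S̄|·w*_a`, and
(2) `∑_{j∈T} w(q,j) ≤ ∑_{j∈T∩S̄} w(b,j) + 2|T∩S̄|·w*_a + 2|T∖S̄|·w*_a`. -/
theorem stmt14 {V : Type*} [Fintype V] [DecidableEq V]
    (w : V → V → ℝ)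
    (hsymm : ∀ x y, w x y = w y x)
    (hnonneg : ∀ x y, 0 ≤ w x y)
    (hzero : ∀ x, w x x = 0)
    (htri : ∀ x y z, w x z ≤ w x y + w y z)
    (Sbar : Finset V) (a : V) (ha : a ∉ Sbar)
    (b : V) (hb : b ∉ Sbar) (hbna : b ≠ a)
    (hbmax : ∀ c : V, c ∉ Sbar → c ≠ a → w a c ≤ w a b)
    (T : Finset V) (p q : V) (hp : p ∉ Sbar) (hq : q ∉ Sbar) :
    (∑ j ∈ T, w p j ≤
      (∑ j ∈ T ∩ Sbar, w a j) + ((T ∩ Sbar).card : ℝ) * w a b +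
        2 * ((T \ Sbar).card : ℝ) * w a b) ∧
    (∑ j ∈ T, w q j ≤
      (∑ j ∈ T ∩ Sbar, w b j) + 2 * ((T ∩ Sbar).card : ℝ) * w a b +
        2 * ((T \ Sbar).card : ℝ) * w a b) := by
  have outside : ∀ c, c ∉ Sbar → w a c ≤ w a b := by
    intro c hc
    by_cases h : c = a
    · rw [h, hzero]
      exact hnonneg a b
    · exact hbmax c hc h
  have sum_le : ∀ (x y : V) (r : ℝ), x ∉ Sbar → (∀ j, w x j ≤ w y j + r) →
      ∑ j ∈ T, w x j ≤ (∑ j ∈ T ∩ Sbar, w y j) + ((T ∩ Sbar).card : ℝ) * r +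
        2 * ((T \ Sbar).card : ℝ) * w a b := by
    intro x y r hx hxy
    rw [← Finset.sum_inter_add_sum_sdiff T Sbar]
    have inside_le : ∑ j ∈ T ∩ Sbar, w x j ≤ ∑ j ∈ T ∩ Sbar, (w y j + r) :=
      Finset.sum_le_sum fun j _ => hxy j
    have outside_le : ∑ j ∈ T \ Sbar, w x j ≤ ∑ _j ∈ T \ Sbar, 2 * w a b := by
      refine Finset.sum_le_sum fun j hj => ?_
      linarith [htri x a j, hsymm x a, outside x hx, outside j (Finset.mem_sdiff.mp hj).2]
    rw [Finset.sum_add_distrib, Finset.sum_const, nsmul_eq_mul] at inside_le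
    rw [Finset.sum_const, nsmul_eq_mul] at outside_le
    linarith
  constructor
  · refine sum_le p a (w a b) hp fun j => ?_
    linarith [htri p a j, hsymm p a, outside p hp]
  · have h := sum_le q b (2 * w a b) hq fun j => by
      linarith [htri q a j, htri a b j, hsymm q a, outside q hq]
    linarith
end

section
/- Let |V| = N ≥ 2 and let (O₁, …, O_k) be a partition of V into k disjoint sets each of size γ = N/k with γ ≥ 1. Then Σᵢ₌₁^k w(Oᵢ) ≤ (2(γ−1)/(N−1))·w(V), i.e., the total within-cluster weight of the partition is at most 2(γ−1)/(N−1) times the sum of w over all unordered pairs of distinct elements of V. -/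
/-- Averaging the triangle inequality over all intermediate points bounds the weight within `A`
by the total weight of the pairs meeting `A`. -/
theorem card_mul_sum_le_of_triangle {V : Type*} [Fintype V] [DecidableEq V] {w : V → V → ℝ}
    (hsymm : ∀ x y, w x y = w y x) (hzero : ∀ x, w x x = 0)
    (htri : ∀ x y z, w x z ≤ w x y + w y z) (A : Finset V) :
    (Fintype.card V : ℝ) * ∑ x ∈ A, ∑ y ∈ A, w x y ≤
      2 * ((A.card : ℝ) - 1) * ∑ x ∈ A, ∑ z, w x z := by
  have key (x y : V) : (Fintype.card V : ℝ) * w x y ≤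
      (∑ z, w x z) + (∑ z, w y z) - if x = y then 2 * ∑ z, w x z else 0 := by
    split_ifs with h
    · subst h
      rw [hzero]
      linarith
    · have hsum : ∑ _z : V, w x y ≤ ∑ z, (w x z + w y z) :=
        Finset.sum_le_sum fun z _ => (htri x z y).trans_eq (by rw [hsymm z y])
      simpa [Finset.sum_add_distrib] using hsum
  calc (Fintype.card V : ℝ) * ∑ x ∈ A, ∑ y ∈ A, w x y
      = ∑ x ∈ A, ∑ y ∈ A, (Fintype.card V : ℝ) * w x y := by simp only [Finset.mul_sum]
    _ ≤ ∑ x ∈ A, ∑ y ∈ A, ((∑ z, w x z) + (∑ z, w y z) -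
          if x = y then 2 * ∑ z, w x z else 0) :=
        Finset.sum_le_sum fun x _ => Finset.sum_le_sum fun y _ => key x y
    _ = ∑ x ∈ A, ((A.card : ℝ) * (∑ z, w x z) + (∑ y ∈ A, ∑ z, w y z) - 2 * ∑ z, w x z) := by
        refine Finset.sum_congr rfl fun x hx => ?_
        rw [Finset.sum_sub_distrib, Finset.sum_add_distrib, Finset.sum_ite_eq, if_pos hx,
          Finset.sum_const, nsmul_eq_mul]
    _ = 2 * ((A.card : ℝ) - 1) * ∑ x ∈ A, ∑ z, w x z := by
        rw [Finset.sum_sub_distrib, Finset.sum_add_distrib, ← Finset.mul_sum, ← Finset.mul_sum,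
          Finset.sum_const, nsmul_eq_mul]
        ring

/-- for any partition of `V` (`|V| = N ≥ 2`) into `k` clusters of equal
size `γ ≥ 1`, the total within-cluster weight is at most `2(γ−1)/(N−1)` times the total
weight `w(V)`, where `w(A) = (1/2)∑_{x,y∈A} w(x,y)`. -/
theorem stmt15 {V : Type*} [Fintype V] [DecidableEq V]
    (w : V → V → ℝ)
    (hsymm : ∀ x y, w x y = w y x)
    (hnonneg : ∀ x y, 0 ≤ w x y)
    (hzero : ∀ x, w x x = 0)
    (htri : ∀ x y z, w x z ≤ w x y + w y z)
    (N k γ : ℕ) (hN : Fintype.card V = N) (hN2 : 2 ≤ N)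
    (hγ : 1 ≤ γ) (hkγ : N = k * γ)
    (O : Fin k → Finset V)
    (hdisj : ∀ i j : Fin k, i ≠ j → Disjoint (O i) (O j))
    (hcover : Finset.univ.biUnion O = (Finset.univ : Finset V))
    (hsize : ∀ i : Fin k, (O i).card = γ) :
    ∑ i : Fin k, (1/2) * ∑ x ∈ O i, ∑ y ∈ O i, w x y ≤
      (2 * ((γ : ℝ) - 1) / ((N : ℝ) - 1)) *
        ((1/2) * ∑ x : V, ∑ y : V, w x y) := by
  have htotal : ∑ i, ∑ x ∈ O i, ∑ y, w x y = ∑ x, ∑ y, w x y := by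
    rw [← hcover, Finset.sum_biUnion fun i _ j _ hij => hdisj i j hij, hcover]
  have hwithin : (N : ℝ) * ∑ i, ∑ x ∈ O i, ∑ y ∈ O i, w x y ≤
      2 * ((γ : ℝ) - 1) * ∑ x, ∑ y, w x y := by
    rw [← htotal, Finset.mul_sum, Finset.mul_sum]
    refine Finset.sum_le_sum fun i _ => ?_
    simpa only [hN, hsize] using card_mul_sum_le_of_triangle hsymm hzero htri (O i)
  have hpos : 0 ≤ ∑ i, ∑ x ∈ O i, ∑ y ∈ O i, w x y :=
    Finset.sum_nonneg fun i _ => Finset.sum_nonneg fun x _ => Finset.sum_nonneg fun y _ =>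
      hnonneg x y
  have hN1 : (0 : ℝ) < (N : ℝ) - 1 := by
    have : (2 : ℝ) ≤ N := by exact_mod_cast hN2
    linarith
  rw [← Finset.mul_sum, div_mul_eq_mul_div (2 * ((γ : ℝ) - 1)), le_div_iff₀ hN1]
  linarith
end

section
/- For any four nodes a, b, x, y, it holds that max( w(a,x) + w(b,y), w(a,y) + w(b,x) ) ≥ w(a,b); more precisely, if w(a,x) ≥ w(a,y) then w(a,x) + w(b,y) ≥ w(a,b). Consequently, two vertex-disjoint Hamiltonian paths H₁ (with endpoints a, b) and H₂ (with endpoints x, y) can always be joined by two connecting edges into a single cycle T with w(T) ≥ w(H₁) + w(H₂) + w(a,b). -/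
/-- The weight of a path given as a list of nodes: the sum of `w` over consecutive
pairs. -/
def pathWeight {V : Type*} (w : V → V → ℝ) : List V → ℝ
  | [] => 0
  | [_] => 0
  | v :: u :: rest => w v u + pathWeight w (u :: rest)

theorem pathWeight_append {V : Type*} (w : V → V → ℝ) {L₁ L₂ : List V} {b x : V}
    (hb : L₁.getLast? = some b) (hx : L₂.head? = some x) :
    pathWeight w (L₁ ++ L₂) = pathWeight w L₁ + w b x + pathWeight w L₂ := by
  obtain ⟨t, rfl⟩ := List.head?_eq_some_iff.mp hx
  induction L₁ with
  | nil => simp at hb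
  | cons u l ih =>
    cases l with
    | nil =>
      obtain rfl : u = b := by simpa using hb
      simp [pathWeight]
    | cons v l =>
      have h := ih (by simpa [List.getLast?_cons_cons] using hb)
      simp only [List.cons_append, pathWeight] at h ⊢
      linarith

theorem pathWeight_reverse {V : Type*} (w : V → V → ℝ) (hsymm : ∀ x y, w x y = w y x)
    (L : List V) : pathWeight w L.reverse = pathWeight w L := by
  induction L with
  | nil => rfl
  | cons u l ih =>
    cases l with
    | nil => rfl
    | cons v l =>
      rw [List.reverse_cons, pathWeight_append w (b := v) (x := u) (by simp) rfl, ih, hsymm v u]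
      simp only [pathWeight]
      ring

/-- The weight of the cycle obtained by joining two paths end to end. -/
theorem pathWeight_append_close {V : Type*} (w : V → V → ℝ) {L₁ L₂ : List V} {a b x y : V}
    (ha : L₁.head? = some a) (hb : L₁.getLast? = some b)
    (hx : L₂.head? = some x) (hy : L₂.getLast? = some y) :
    pathWeight w ((L₁ ++ L₂) ++ (L₁ ++ L₂).take 1) =
      pathWeight w L₁ + w b x + pathWeight w L₂ + w y a := by
  have htake : (L₁ ++ L₂).take 1 = [a] := by
    obtain ⟨t, rfl⟩ := List.head?_eq_some_iff.mp ha
    simp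
  rw [htake, pathWeight_append w (b := y) (x := a) (by simp [List.getLast?_append, hy]) rfl,
    pathWeight_append w hb hx]
  simp [pathWeight]

/-- for any four nodes `a,b,x,y` of a metric,
`max(w(a,x)+w(b,y), w(a,y)+w(b,x)) ≥ w(a,b)`, and more precisely if `w(a,x) ≥ w(a,y)`
then `w(a,x) + w(b,y) ≥ w(a,b)`. Consequently, two vertex-disjoint Hamiltonian paths
`L₁` (endpoints `a,b`) and `L₂` (endpoints `x,y`) can be joined (by appending `L₂` or
its reverse and closing up the cycle) into a cycle `L` with
`w(L) ≥ w(L₁) + w(L₂) + w(a,b)`. -/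
theorem stmt17 {V : Type*}
    (w : V → V → ℝ)
    (hsymm : ∀ x y, w x y = w y x)
    (hnonneg : ∀ x y, 0 ≤ w x y)
    (hzero : ∀ x, w x x = 0)
    (htri : ∀ x y z, w x z ≤ w x y + w y z)
    (a b x y : V)
    (L₁ L₂ : List V)
    (hL₁head : L₁.head? = some a) (hL₁last : L₁.getLast? = some b)
    (hL₂head : L₂.head? = some x) (hL₂last : L₂.getLast? = some y)
    (hdisj : ∀ v ∈ L₁, v ∉ L₂) :
    (w a y ≤ w a x → w a b ≤ w a x + w b y) ∧
    w a b ≤ max (w a x + w b y) (w a y + w b x) ∧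
    ∃ L : List V, (L = L₁ ++ L₂ ∨ L = L₁ ++ L₂.reverse) ∧
      pathWeight w L₁ + pathWeight w L₂ + w a b ≤
        pathWeight w (L ++ L.take 1) := by
  have hxy : w a y ≤ w a x → w a b ≤ w a x + w b y := fun h => by
    linarith [htri a y b, hsymm y b]
  have hyx : w a x ≤ w a y → w a b ≤ w a y + w b x := fun h => by
    linarith [htri a x b, hsymm x b]
  refine ⟨hxy, ?_, ?_⟩
  · rcases le_total (w a y) (w a x) with h | h
    · exact le_max_of_le_left (hxy h)
    · exact le_max_of_le_right (hyx h)
  · rcases le_total (w a y) (w a x) with h | h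
    · refine ⟨L₁ ++ L₂.reverse, Or.inr rfl, ?_⟩
      rw [pathWeight_append_close w hL₁head hL₁last (x := y) (y := x) (by simpa using hL₂last)
        (by simpa using hL₂head), pathWeight_reverse w hsymm]
      linarith [hxy h, hsymm x a]
    · refine ⟨L₁ ++ L₂, Or.inl rfl, ?_⟩
      rw [pathWeight_append_close w hL₁head hL₁last hL₂head hL₂last]
      linarith [hyx h, hsymm y a]
end

section
/- Let V be a finite set with |V| = 2k for an integer k ≥ 1, and let M = { {x₁,y₁}, …, {x_k,y_k} } be a perfect matching on V with weight w(M) = Σᵢ w(xᵢ,yᵢ). Then there exists an ordering v₁, v₂, …, v_{2k} of the elements of V such that {v_{2i−1}, v_{2i}} ∈ M for every 1 ≤ i ≤ k (so the Hamiltonian path v₁−v₂−⋯−v_{2k} contains every edge of M), and Σ_{j=1}^{2k−1} w(v_j, v_{j+1}) ≥ (3/2 − 1/k)·w(M). -/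
/-- Orient the pairs `(P i, Q i)` greedily, each new pair starting at the endpoint
farther from the current end of the path. -/
noncomputable def greedyOrient {V : Type*} (w : V → V → ℝ) (P Q : ℕ → V) : ℕ → V × V
  | 0 => (P 0, Q 0)
  | n + 1 =>
    if w (greedyOrient w P Q n).2 (Q (n + 1)) ≤ w (greedyOrient w P Q n).2 (P (n + 1)) then
      (P (n + 1), Q (n + 1))
    else (Q (n + 1), P (n + 1))

/-- The path that runs through the greedily oriented pairs. -/
noncomputable def greedyPath {V : Type*} (w : V → V → ℝ) (P Q : ℕ → V) (j : ℕ) : V :=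
  if j % 2 = 0 then (greedyOrient w P Q (j / 2)).1 else (greedyOrient w P Q (j / 2)).2

theorem greedyPath_two_mul {V : Type*} (w : V → V → ℝ) (P Q : ℕ → V) (i : ℕ) :
    greedyPath w P Q (2 * i) = (greedyOrient w P Q i).1 := by
  simp [greedyPath]

theorem greedyPath_two_mul_add_one {V : Type*} (w : V → V → ℝ) (P Q : ℕ → V) (i : ℕ) :
    greedyPath w P Q (2 * i + 1) = (greedyOrient w P Q i).2 := by
  have h : (2 * i + 1) / 2 = i := by omega
  simp [greedyPath, h]

theorem greedyOrient_eq_or {V : Type*} (w : V → V → ℝ) (P Q : ℕ → V) (i : ℕ) :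
    greedyOrient w P Q i = (P i, Q i) ∨ greedyOrient w P Q i = (Q i, P i) := by
  cases i with
  | zero => exact Or.inl rfl
  | succ n =>
    rw [greedyOrient]
    split_ifs
    · exact Or.inl rfl
    · exact Or.inr rfl

theorem weight_greedyOrient {V : Type*} (w : V → V → ℝ) (hsymm : ∀ x y, w x y = w y x)
    (P Q : ℕ → V) (i : ℕ) :
    w (greedyOrient w P Q i).1 (greedyOrient w P Q i).2 = w (P i) (Q i) := by
  rcases greedyOrient_eq_or w P Q i with h | h <;> rw [h]
  exact hsymm _ _

theorem half_weight_le_greedyOrient_link {V : Type*} (w : V → V → ℝ)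
    (hsymm : ∀ x y, w x y = w y x) (htri : ∀ x y z, w x z ≤ w x y + w y z)
    (P Q : ℕ → V) (n : ℕ) :
    w (P (n + 1)) (Q (n + 1)) / 2 ≤
      w (greedyOrient w P Q n).2 (greedyOrient w P Q (n + 1)).1 := by
  have h := htri (P (n + 1)) (greedyOrient w P Q n).2 (Q (n + 1))
  rw [hsymm (P (n + 1)) (greedyOrient w P Q n).2] at h
  rw [greedyOrient]
  split_ifs with hc <;> dsimp only <;> linarith

theorem weight_greedyPath_ge {V : Type*} (w : V → V → ℝ)
    (hsymm : ∀ x y, w x y = w y x) (htri : ∀ x y z, w x z ≤ w x y + w y z)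
    (P Q : ℕ → V) (n : ℕ) :
    3 / 2 * (∑ i ∈ Finset.range (n + 1), w (P i) (Q i)) - w (P 0) (Q 0) / 2 ≤
      ∑ j ∈ Finset.range (2 * n + 1), w (greedyPath w P Q j) (greedyPath w P Q (j + 1)) := by
  induction n with
  | zero =>
    have h0 : greedyPath w P Q 0 = P 0 := rfl
    have h1 : greedyPath w P Q 1 = Q 0 := rfl
    simp only [zero_add, Finset.sum_range_one, mul_zero, h0, h1]
    linarith
  | succ n ih =>
    rw [Finset.sum_range_succ, show 2 * (n + 1) + 1 = 2 * n + 1 + 1 + 1 by ring,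
      Finset.sum_range_succ _ (2 * n + 1 + 1), Finset.sum_range_succ _ (2 * n + 1),
      show 2 * n + 1 + 1 = 2 * (n + 1) by ring]
    simp only [greedyPath_two_mul, greedyPath_two_mul_add_one]
    have h1 := half_weight_le_greedyOrient_link w hsymm htri P Q n
    have h2 := weight_greedyOrient w hsymm P Q (n + 1)
    linarith

/-- given a perfect matching `{x₁,y₁},…,{x_k,y_k}` on `V` (`|V| = 2k`),
there is an ordering `v 0, v 1, …, v (2k−1)` of the elements of `V` whose consecutive
odd/even positions are exactly edges of the matching, such that the Hamiltonian path
through this ordering has weight at least `(3/2 − 1/k)` times the matching weight. -/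
theorem stmt18 {V : Type*} [Fintype V] [DecidableEq V]
    (w : V → V → ℝ)
    (hsymm : ∀ x y, w x y = w y x)
    (hnonneg : ∀ x y, 0 ≤ w x y)
    (hzero : ∀ x, w x x = 0)
    (htri : ∀ x y z, w x z ≤ w x y + w y z)
    (k : ℕ) (hk : 1 ≤ k) (hcard : Fintype.card V = 2 * k)
    (p q : Fin k → V)
    (hp : Function.Injective p) (hq : Function.Injective q)
    (hpq : ∀ i j, p i ≠ q j) :
    ∃ v : ℕ → V,
      (∀ u : V, ∃! j : ℕ, j < 2 * k ∧ v j = u) ∧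
      (∀ i : ℕ, i < k → ∃ j : Fin k,
        (v (2 * i) = p j ∧ v (2 * i + 1) = q j) ∨
        (v (2 * i) = q j ∧ v (2 * i + 1) = p j)) ∧
      (3/2 - 1/(k : ℝ)) * (∑ i, w (p i) (q i)) ≤
        ∑ j ∈ Finset.range (2 * k - 1), w (v j) (v (j + 1)) := by
  obtain ⟨n, rfl⟩ : ∃ n, k = n + 1 := ⟨k - 1, by omega⟩
  obtain ⟨j₀, -, hmin⟩ := Finset.exists_min_image Finset.univ (fun i => w (p i) (q i))
    ⟨(0 : Fin (n + 1)), Finset.mem_univ _⟩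
  let σ : Equiv.Perm (Fin (n + 1)) := Equiv.swap 0 j₀
  let P : ℕ → V := fun i => p (σ (Fin.ofNat (n + 1) i))
  let Q : ℕ → V := fun i => q (σ (Fin.ofNat (n + 1) i))
  have hval : ∀ i : Fin (n + 1), Fin.ofNat (n + 1) i = i := fun i => by simp
  have hsurj : ∀ u : V, ∃ i < n + 1, u = P i ∨ u = Q i := by
    have hinj : Function.Injective (Sum.elim p q) := hp.sumElim hq hpq
    have hbij := (Fintype.bijective_iff_injective_and_card _).2
      ⟨hinj, by rw [hcard, Fintype.card_sum, Fintype.card_fin]; ring⟩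
    intro u
    obtain ⟨i | i, rfl⟩ := hbij.2 u
    · exact ⟨(σ.symm i).val, (σ.symm i).isLt, Or.inl (by simp only [P, hval]; simp)⟩
    · exact ⟨(σ.symm i).val, (σ.symm i).isLt, Or.inr (by simp only [Q, hval]; simp)⟩
  have hhit : ∀ u : V, ∃ j < 2 * (n + 1), greedyPath w P Q j = u := by
    intro u
    obtain ⟨i, hi, hu⟩ := hsurj u
    have h1 := greedyPath_two_mul w P Q i
    have h2 := greedyPath_two_mul_add_one w P Q i
    rcases greedyOrient_eq_or w P Q i with h | h <;> rw [h] at h1 h2 <;>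
      rcases hu with rfl | rfl <;>
      first
      | exact ⟨2 * i, by omega, h1⟩
      | exact ⟨2 * i + 1, by omega, h2⟩
  refine ⟨greedyPath w P Q, ?_, ?_, ?_⟩
  · have hs : Function.Surjective (fun j : Fin (2 * (n + 1)) => greedyPath w P Q j) := by
      intro u
      obtain ⟨j, hj, h⟩ := hhit u
      exact ⟨⟨j, hj⟩, h⟩
    have hbij := (Fintype.bijective_iff_surjective_and_card _).2
      ⟨hs, by rw [hcard, Fintype.card_fin]⟩
    intro u
    obtain ⟨j, hj, h⟩ := hhit u
    refine ⟨j, ⟨hj, h⟩, ?_⟩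
    rintro j' ⟨hj', h'⟩
    exact congrArg Fin.val (@hbij.1 ⟨j', hj'⟩ ⟨j, hj⟩ (h'.trans h.symm))
  · intro i _
    refine ⟨σ (Fin.ofNat (n + 1) i), ?_⟩
    rw [greedyPath_two_mul, greedyPath_two_mul_add_one]
    rcases greedyOrient_eq_or w P Q i with h | h <;> rw [h]
    · exact Or.inl ⟨rfl, rfl⟩
    · exact Or.inr ⟨rfl, rfl⟩
  · have hsum : ∑ i ∈ Finset.range (n + 1), w (P i) (Q i) = ∑ i, w (p i) (q i) := by
      rw [Finset.sum_range, ← Equiv.sum_comp σ (fun i => w (p i) (q i))]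
      simp only [P, Q, hval]
    have hfirst : w (P 0) (Q 0) = w (p j₀) (q j₀) := by
      have h : σ (Fin.ofNat (n + 1) 0) = j₀ := Equiv.swap_apply_left 0 j₀
      simp only [P, Q, h]
    have hpath := weight_greedyPath_ge w hsymm htri P Q n
    rw [hsum, hfirst] at hpath
    have hmean : w (p j₀) (q j₀) ≤ 1 / ((n + 1 : ℕ) : ℝ) * ∑ i, w (p i) (q i) := by
      have h := Finset.card_nsmul_le_sum Finset.univ (fun i => w (p i) (q i)) _ hmin
      rw [Finset.card_univ, Fintype.card_fin, nsmul_eq_mul] at h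
      rw [one_div, inv_mul_eq_div, le_div_iff₀ (by positivity), mul_comm]
      exact h
    have hpos := hnonneg (p j₀) (q j₀)
    rw [show 2 * (n + 1) - 1 = 2 * n + 1 by omega, sub_mul]
    linarith
end
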